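/- arXiv:1807.08648 — 2 statements merged into one kernel-verified Lean document; each statement's English description precedes it below -/
import Mathlib

section
/- Let P be a Schröder word of word length ℓ (its number of letters), and write P = F_1 F_2 ⋯ F_k for its unique factorization into irreducible Schröder factors. For each i let f_i be the number of U steps of F_i (which equals its number of D steps) and h_i the number of H steps of F_i, so φ_i := f_i + h_i is the semilength of F_i. Then the number of Schröder words Q with P ≤ Q and semilength(Q) = semilength(P) + 1 equals 2 + ℓ + Σ_{1 ≤ i ≤ j ≤ k} (f_i + h_i)(f_j + h_j). -/
/-- Steps of a Schröder path: `U` = (1,1), `D` = (1,-1), `H` = (2,0). -/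
inductive Step : Type
  | U : Step
  | D : Step
  | H : Step
  deriving DecidableEq

/-- Number of `U` steps of a word. -/
def countU (w : List Step) : ℕ := w.count Step.U

/-- Number of `D` steps of a word. -/
def countD (w : List Step) : ℕ := w.count Step.D

/-- Number of `H` steps of a word. -/
def countH (w : List Step) : ℕ := w.count Step.H

/-- A word is a Schröder word if every prefix has at least as many `U`'s as `D`'s
and the whole word has equally many `U`'s and `D`'s. -/
def IsSchroder (w : List Step) : Prop :=
  (∀ p : List Step, p <+: w → countD p ≤ countU p) ∧ countU w = countD w

/-- The semilength of a Schröder word. -/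
def semilength (w : List Step) : ℕ := countU w + countH w

/-- An irreducible Schröder factor: a nonempty Schröder word all of whose proper
nonempty prefixes have strictly more `U`'s than `D`'s. -/
def IsIrreducibleFactor (w : List Step) : Prop :=
  w ≠ [] ∧ IsSchroder w ∧
    ∀ p : List Step, p <+: w → p ≠ [] → p ≠ w → countD p < countU p

open Step

/-- Valid path word starting at height `h` and ending at height `0`. -/
def VV : ℕ → List Step → Prop
  | h, [] => h = 0
  | h, U :: w => VV (h + 1) w
  | 0, D :: _ => False
  | h + 1, D :: w => VV h w
  | h, H :: w => VV h w

/-- Path word starting at height `h` and reaching `0` exactly at its end. -/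
def FR : ℕ → List Step → Prop
  | 0, w => w = []
  | _ + 1, [] => False
  | h + 1, U :: w => FR (h + 2) w
  | h + 1, D :: w => FR h w
  | h + 1, H :: w => FR (h + 1) w

@[simp] theorem cU_nil : countU [] = 0 := rfl
@[simp] theorem cD_nil : countD [] = 0 := rfl
@[simp] theorem cH_nil : countH [] = 0 := rfl
@[simp] theorem cU_U (w) : countU (U :: w) = countU w + 1 := by simp [countU]
@[simp] theorem cU_D (w) : countU (D :: w) = countU w := by simp [countU]
@[simp] theorem cU_H (w) : countU (H :: w) = countU w := by simp [countU]
@[simp] theorem cD_U (w) : countD (U :: w) = countD w := by simp [countD]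
@[simp] theorem cD_D (w) : countD (D :: w) = countD w + 1 := by simp [countD]
@[simp] theorem cD_H (w) : countD (H :: w) = countD w := by simp [countD]
@[simp] theorem cH_U (w) : countH (U :: w) = countH w := by simp [countH]
@[simp] theorem cH_D (w) : countH (D :: w) = countH w := by simp [countH]
@[simp] theorem cH_H (w) : countH (H :: w) = countH w + 1 := by simp [countH]
@[simp] theorem cU_app (v w) : countU (v ++ w) = countU v + countU w := by simp [countU]
@[simp] theorem cD_app (v w) : countD (v ++ w) = countD v + countD w := by simp [countD]
@[simp] theorem cH_app (v w) : countH (v ++ w) = countH v + countH w := by simp [countH]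

theorem length_counts (w : List Step) : w.length = countU w + countD w + countH w := by
  induction w with
  | nil => rfl
  | cons x w ih => cases x <;> simp [ih] <;> omega

theorem forall_prefix_cons {x : Step} {w : List Step} {p : List Step → Prop} :
    (∀ q, q <+: x :: w → p q) ↔ p [] ∧ ∀ q, q <+: w → p (x :: q) := by
  constructor
  · intro h
    exact ⟨h _ (List.nil_prefix), fun q hq => h _ (by simpa using hq)⟩
  · rintro ⟨h0, h1⟩ q hq
    rcases List.prefix_cons_iff.1 hq with rfl | ⟨t, rfl, ht⟩
    · exact h0
    · exact h1 _ ht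

theorem VV_iff (w : List Step) (h : ℕ) :
    VV h w ↔ (∀ p, p <+: w → countD p ≤ h + countU p) ∧ h + countU w = countD w := by
  induction w generalizing h with
  | nil => simp [VV]
  | cons x w ih =>
    rw [forall_prefix_cons]
    cases x with
    | U =>
      simp only [VV, ih, cU_U, cD_U, cD_nil, cU_nil]
      constructor
      · rintro ⟨h1, h2⟩
        exact ⟨⟨by omega, fun q hq => by have := h1 q hq; omega⟩, by omega⟩
      · rintro ⟨⟨-, h1⟩, h2⟩
        exact ⟨fun q hq => by have := h1 q hq; omega, by omega⟩
    | H => simp [VV, ih]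
    | D =>
      cases h with
      | zero =>
        simp only [VV, false_iff]
        rintro ⟨⟨-, h1⟩, -⟩
        have := h1 [] List.nil_prefix
        simp at this
      | succ h =>
        simp only [VV, ih, cU_D, cD_D, cD_nil, cU_nil]
        constructor
        · rintro ⟨h1, h2⟩
          exact ⟨⟨by omega, fun q hq => by have := h1 q hq; omega⟩, by omega⟩
        · rintro ⟨⟨-, h1⟩, h2⟩
          exact ⟨fun q hq => by have := h1 q hq; omega, by omega⟩

theorem isSchroder_iff (w : List Step) : IsSchroder w ↔ VV 0 w := by
  simp [VV_iff, IsSchroder]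

theorem FR_of (w : List Step) (h : ℕ) (h1 : h + countU w = countD w)
    (h2 : ∀ p, p <+: w → p ≠ w → countD p < h + countU p) : FR h w := by
  induction w generalizing h with
  | nil => simp at h1; subst h1; simp [FR]
  | cons x w ih =>
    rw [forall_prefix_cons] at h2
    obtain ⟨h0, h2⟩ := h2
    have h0 := h0 (by simp)
    obtain ⟨h, rfl⟩ : ∃ k, h = k + 1 := ⟨h - 1, by simp at h0; omega⟩
    have h3 : ∀ q, q <+: w → q ≠ w → countD (x :: q) < h + 1 + countU (x :: q) :=
      fun q hq hn => h2 q hq (by simpa using hn)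
    cases x with
    | U =>
      simp only [FR]
      simp only [cU_U, cD_U] at h1 h3
      exact ih _ (by omega) fun q hq hn => by have := h3 q hq hn; omega
    | D =>
      simp only [FR]
      simp only [cU_D, cD_D] at h1 h3
      exact ih _ (by omega) fun q hq hn => by have := h3 q hq hn; omega
    | H =>
      simp only [FR]
      simp only [cU_H, cD_H] at h1 h3
      exact ih _ (by omega) fun q hq hn => by have := h3 q hq hn; omega

theorem FR_counts (w : List Step) (h : ℕ) (hw : FR h w) : h + countU w = countD w := by
  induction w generalizing h with
  | nil => cases h <;> simp_all [FR]
  | cons x w ih =>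
    cases h with
    | zero => simp [FR] at hw
    | succ h =>
      cases x <;> simp only [FR] at hw <;> have := ih _ hw <;> simp <;> omega

theorem irr_cases (w : List Step) (hw : IsIrreducibleFactor w) :
    w = [H] ∨ ∃ v, w = U :: v ∧ FR 1 v := by
  obtain ⟨hne, ⟨hs1, hs2⟩, hp⟩ := hw
  cases w with
  | nil => exact absurd rfl hne
  | cons x w =>
    rw [forall_prefix_cons] at hs1 hp
    cases x with
    | D => have := hs1.2 [] List.nil_prefix; simp at this
    | H =>
      left
      by_contra hc
      have := hp.2 [] List.nil_prefix (by simp) (fun h => hc h.symm)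
      simp at this
    | U =>
      right
      refine ⟨w, rfl, FR_of _ _ (by simp at hs2; omega) fun q hq hn => ?_⟩
      have := hp.2 q hq (by simp) (by simpa using hn)
      simp at this
      omega

/-- Words covering `P` with prescribed extra letters. -/
def SS (P : List Step) (h a b c : ℕ) : Set (List Step) :=
  {Q | P.Sublist Q ∧ VV h Q ∧ countU Q = countU P + a ∧ countD Q = countD P + b ∧
    countH Q = countH P + c}

theorem finite_of_length (n : ℕ) : {l : List Step | l.length ≤ n}.Finite := by
  haveI : Finite Step := by
    refine Finite.of_injective
      (fun s : Step => match s with | U => (0 : Fin 3) | D => 1 | H => 2) ?_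
    intro x y
    cases x <;> cases y <;> simp
  exact List.finite_length_le Step n

theorem SS_finite (P h a b c) : (SS P h a b c).Finite := by
  refine (finite_of_length (countU P + a + (countD P + b) + (countH P + c))).subset ?_
  rintro Q ⟨-, -, h1, h2, h3⟩
  simp [length_counts, h1, h2, h3]

theorem ncard_split (S : Set (List Step)) (hf : S.Finite) (h0 : [] ∉ S) :
    S.ncard = {Q | U :: Q ∈ S}.ncard + {Q | D :: Q ∈ S}.ncard + {Q | H :: Q ∈ S}.ncard := by
  have hS : S = (List.cons U '' {Q | U :: Q ∈ S} ∪ List.cons D '' {Q | D :: Q ∈ S}) ∪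
      List.cons H '' {Q | H :: Q ∈ S} := by
    ext Q
    cases Q with
    | nil => simp [h0]
    | cons x Q => cases x <;> simp
  have hu : (List.cons U '' {Q | U :: Q ∈ S}).Finite := hf.subset (by rintro _ ⟨Q, hQ, rfl⟩; exact hQ)
  have hd : (List.cons D '' {Q | D :: Q ∈ S}).Finite := hf.subset (by rintro _ ⟨Q, hQ, rfl⟩; exact hQ)
  have hh : (List.cons H '' {Q | H :: Q ∈ S}).Finite := hf.subset (by rintro _ ⟨Q, hQ, rfl⟩; exact hQ)
  conv_lhs => rw [hS]
  rw [Set.ncard_union_eq _ (hu.union hd) hh, Set.ncard_union_eq _ hu hd,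
    Set.ncard_image_of_injective _ List.cons_injective,
    Set.ncard_image_of_injective _ List.cons_injective,
    Set.ncard_image_of_injective _ List.cons_injective]
  · rw [Set.disjoint_left]; rintro _ ⟨Q, hQ, rfl⟩ ⟨R, hR, hc⟩; simp at hc
  · rw [Set.disjoint_left]; rintro _ (⟨Q, hQ, rfl⟩ | ⟨Q, hQ, rfl⟩) ⟨R, hR, hc⟩ <;> simp at hc

theorem sub_ne {x y : Step} (hxy : x ≠ y) (P Q : List Step) :
    (x :: P).Sublist (y :: Q) ↔ (x :: P).Sublist Q := by
  constructor
  · intro h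
    cases h with
    | cons _ h => exact h
    | cons_cons _ h => exact absurd rfl hxy
  · exact fun h => h.cons _

theorem SS_zero (P h) (hP : VV h P) : (SS P h 0 0 0).ncard = 1 := by
  rw [Set.ncard_eq_one]
  refine ⟨P, ?_⟩
  ext Q
  simp only [SS, Set.mem_setOf_eq, Set.mem_singleton_iff]
  constructor
  · rintro ⟨h1, -, h2, h3, h4⟩
    exact (h1.eq_of_length (by rw [length_counts, length_counts]; omega)).symm
  · rintro rfl
    exact ⟨List.Sublist.refl _, hP, rfl, rfl, rfl⟩

theorem split_cons (x P h a b c) : (SS (x :: P) h a b c).ncard =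
    {Q | U :: Q ∈ SS (x :: P) h a b c}.ncard + {Q | D :: Q ∈ SS (x :: P) h a b c}.ncard +
      {Q | H :: Q ∈ SS (x :: P) h a b c}.ncard :=
  ncard_split _ (SS_finite _ _ _ _ _) (by simp [SS])

theorem der_UU (P h a b c) : {Q | U :: Q ∈ SS (U :: P) h a b c} = SS P (h + 1) a b c := by
  ext Q
  simp only [SS, Set.mem_setOf_eq, List.cons_sublist_cons, VV, cU_U, cD_U, cH_U]
  grind

theorem der_HH (P h a b c) : {Q | H :: Q ∈ SS (H :: P) h a b c} = SS P h a b c := by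
  ext Q
  simp only [SS, Set.mem_setOf_eq, List.cons_sublist_cons, VV, cU_H, cD_H, cH_H]
  grind

theorem der_DD (P h a b c) : {Q | D :: Q ∈ SS (D :: P) (h + 1) a b c} = SS P h a b c := by
  ext Q
  simp only [SS, Set.mem_setOf_eq, List.cons_sublist_cons, VV, cU_D, cD_D, cH_D]
  grind

theorem der_D0 (P a b c) : {Q | D :: Q ∈ SS P 0 a b c} = ∅ := by
  ext Q
  simp [SS, VV]

theorem der_U (x P h a b c) (hx : x ≠ U) :
    {Q | U :: Q ∈ SS (x :: P) h (a + 1) b c} = SS (x :: P) (h + 1) a b c := by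
  ext Q
  simp only [SS, Set.mem_setOf_eq, sub_ne hx, VV, cU_U, cD_U, cH_U]
  grind

theorem der_D (x P h a b c) (hx : x ≠ D) :
    {Q | D :: Q ∈ SS (x :: P) (h + 1) a (b + 1) c} = SS (x :: P) h a b c := by
  ext Q
  simp only [SS, Set.mem_setOf_eq, sub_ne hx, VV, cU_D, cD_D, cH_D]
  grind

theorem der_H (x P h a b c) (hx : x ≠ H) :
    {Q | H :: Q ∈ SS (x :: P) h a b (c + 1)} = SS (x :: P) h a b c := by
  ext Q
  simp only [SS, Set.mem_setOf_eq, sub_ne hx, VV, cU_H, cD_H, cH_H]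
  grind

theorem der_U_zero (x P h b c) (hx : x ≠ U) :
    {Q | U :: Q ∈ SS (x :: P) h 0 b c} = ∅ := by
  ext Q
  simp only [SS, Set.mem_setOf_eq, sub_ne hx, Set.mem_empty_iff_false, iff_false, cU_U]
  rintro ⟨h1, -, h2, -⟩
  have := h1.count_le U
  change countU _ ≤ countU _ at this
  omega

theorem der_D_zero (x P h a c) (hx : x ≠ D) :
    {Q | D :: Q ∈ SS (x :: P) h a 0 c} = ∅ := by
  ext Q
  simp only [SS, Set.mem_setOf_eq, sub_ne hx, Set.mem_empty_iff_false, iff_false, cD_D]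
  rintro ⟨h1, -, -, h2, -⟩
  have := h1.count_le D
  change countD _ ≤ countD _ at this
  omega

theorem der_H_zero (x P h a b) (hx : x ≠ H) :
    {Q | H :: Q ∈ SS (x :: P) h a b 0} = ∅ := by
  ext Q
  simp only [SS, Set.mem_setOf_eq, sub_ne hx, Set.mem_empty_iff_false, iff_false, cH_H]
  rintro ⟨h1, -, -, -, h2⟩
  have := h1.count_le H
  change countH _ ≤ countH _ at this
  omega

/-- The empty-word base cases all go through words of small length. -/
theorem SS_nil_D : SS [] 1 0 1 0 = {[D]} := by
  ext Q
  simp only [SS, Set.mem_setOf_eq, Set.mem_singleton_iff, cU_nil, cD_nil, cH_nil]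
  constructor
  · rintro ⟨-, h0, h1, h2, h3⟩
    have hl := length_counts Q
    rw [h1, h2, h3] at hl
    obtain ⟨x, rfl⟩ := List.length_eq_one_iff.1 (by simpa using hl)
    cases x <;> simp_all
  · rintro rfl
    simp [VV]

theorem SS_nil_H : SS [] 0 0 0 1 = {[H]} := by
  ext Q
  simp only [SS, Set.mem_setOf_eq, Set.mem_singleton_iff, cU_nil, cD_nil, cH_nil]
  constructor
  · rintro ⟨-, h0, h1, h2, h3⟩
    have hl := length_counts Q
    rw [h1, h2, h3] at hl
    obtain ⟨x, rfl⟩ := List.length_eq_one_iff.1 (by simpa using hl)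
    cases x <;> simp_all
  · rintro rfl
    simp [VV]

theorem SS_nil_UD : SS [] 0 1 1 0 = {[U, D]} := by
  ext Q
  simp only [SS, Set.mem_setOf_eq, Set.mem_singleton_iff, cU_nil, cD_nil, cH_nil]
  constructor
  · rintro ⟨-, h0, h1, h2, h3⟩
    have hl := length_counts Q
    rw [h1, h2, h3] at hl
    obtain ⟨x, y, rfl⟩ := List.length_eq_two.1 (by simpa using hl)
    cases x <;> cases y <;> simp_all [VV]
  · rintro rfl
    simp [VV]

theorem card_H (P h) (hP : VV h P) : (SS P h 0 0 1).ncard + countH P = P.length + 1 := by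
  induction P generalizing h with
  | nil =>
    simp only [VV] at hP
    subst hP
    simp [SS_nil_H]
  | cons x P ih =>
    rw [split_cons]
    cases x with
    | U =>
      have := SS_zero _ _ hP
      simp only [VV] at hP
      have := ih _ hP
      rw [der_UU, der_D_zero _ _ _ _ _ (by simp), der_H _ _ _ _ _ _ (by simp)]
      simp
      omega
    | D =>
      have := SS_zero _ _ hP
      cases h with
      | zero => simp [VV] at hP
      | succ h =>
      simp only [VV] at hP
      have := ih _ hP
      rw [der_DD, der_U_zero _ _ _ _ _ (by simp), der_H _ _ _ _ _ _ (by simp)]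
      simp
      omega
    | H =>
      simp only [VV] at hP
      have := ih _ hP
      rw [der_HH, der_U_zero _ _ _ _ _ (by simp), der_D_zero _ _ _ _ _ (by simp)]
      simp
      omega

theorem card_D (P h) (hP : VV h P) : (SS P (h + 1) 0 1 0).ncard = 1 + countU P + countH P := by
  induction P generalizing h with
  | nil =>
    simp only [VV] at hP
    subst hP
    simp [SS_nil_D]
  | cons x P ih =>
    rw [split_cons]
    cases x with
    | U =>
      have := SS_zero _ _ hP
      simp only [VV] at hP
      have := ih _ hP
      rw [der_UU, der_D _ _ _ _ _ _ (by simp), der_H_zero _ _ _ _ _ (by simp)]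
      simp
      omega
    | D =>
      cases h with
      | zero => simp [VV] at hP
      | succ h =>
      simp only [VV] at hP
      have := ih _ hP
      rw [der_DD, der_U_zero _ _ _ _ _ (by simp), der_H_zero _ _ _ _ _ (by simp)]
      simp
      omega
    | H =>
      have := SS_zero _ _ hP
      simp only [VV] at hP
      have := ih _ hP
      rw [der_HH, der_U_zero _ _ _ _ _ (by simp), der_D _ _ _ _ _ _ (by simp)]
      simp
      omega

/-- Number of `D` and `H` letters up to the first return to height `0`. -/
def kU : List Step → ℕ → ℕ
  | _, 0 => 0
  | [], _ + 1 => 0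
  | U :: P, h + 1 => kU P (h + 2)
  | D :: P, h + 1 => 1 + kU P h
  | H :: P, h + 1 => 1 + kU P (h + 1)

theorem card_U (P h) (hP : VV (h + 1) P) : (SS P h 1 0 0).ncard = kU P (h + 1) := by
  induction P generalizing h with
  | nil => simp [VV] at hP
  | cons x P ih =>
    rw [split_cons]
    cases x with
    | U =>
      simp only [VV] at hP
      have := ih _ hP
      rw [der_UU, der_D_zero _ _ _ _ _ (by simp), der_H_zero _ _ _ _ _ (by simp)]
      simp [kU]
      omega
    | D =>
      have := SS_zero _ _ hP
      simp only [VV] at hP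
      rw [der_U _ _ _ _ _ _ (by simp), der_H_zero _ _ _ _ _ (by simp)]
      cases h with
      | zero =>
        rw [der_D0, this]
        simp [kU]
      | succ h =>
        have := ih _ hP
        rw [der_DD]
        simp [kU]
        omega
    | H =>
      have := SS_zero _ _ hP
      simp only [VV] at hP
      have := ih _ hP
      rw [der_HH, der_U _ _ _ _ _ _ (by simp), der_D_zero _ _ _ _ _ (by simp)]
      simp [kU]
      omega

/-- Number of valid words obtained by inserting one `U` and one `D`. -/
def gg : List Step → ℕ → ℕ
  | [], _ => 1
  | U :: P, h => gg P (h + 1) + kU (U :: P) h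
  | D :: P, h => gg P (h - 1) + (1 + countU P + countH P)
  | H :: P, h => gg P h + (2 + countU P + countH P) + kU (H :: P) h

theorem card_UD (P h) (hP : VV h P) : (SS P h 1 1 0).ncard = gg P h := by
  induction P generalizing h with
  | nil =>
    simp only [VV] at hP
    subst hP
    simp [SS_nil_UD, gg]
  | cons x P ih =>
    rw [split_cons]
    cases x with
    | U =>
      have hP' := hP
      simp only [VV] at hP
      have := ih _ hP
      rw [der_UU, der_H_zero _ _ _ _ _ (by simp), this]
      cases h with
      | zero => rw [der_D0]; simp [gg, kU]
      | succ h =>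
        rw [der_D _ _ _ _ _ _ (by simp), card_U _ _ hP']
        simp [gg]
    | D =>
      have h1 := card_D _ _ hP
      cases h with
      | zero => simp [VV] at hP
      | succ h =>
      simp only [VV] at hP
      have := ih _ hP
      rw [der_DD, der_H_zero _ _ _ _ _ (by simp), this, der_U _ _ _ _ _ _ (by simp), h1]
      simp [gg]
      omega
    | H =>
      have hP' := hP
      have h1 := card_D _ _ hP
      simp only [VV] at hP
      have := ih _ hP
      rw [der_HH, this, der_U _ _ _ _ _ _ (by simp), h1]
      cases h with
      | zero => rw [der_D0]; simp [gg, kU]; omega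
      | succ h =>
        rw [der_D _ _ _ _ _ _ (by simp), card_U _ _ hP']
        simp [gg]
        omega

theorem kU_app (X R : List Step) (h : ℕ) (hX : FR h X) :
    kU (X ++ R) h = countD X + countH X := by
  induction X generalizing h with
  | nil => cases h <;> simp_all [FR, kU]
  | cons x X ih =>
    cases h with
    | zero => simp [FR] at hX
    | succ h =>
      cases x <;> simp only [FR] at hX <;> have := ih _ hX <;> simp [kU, this] <;> omega

theorem gg_app (X R : List Step) (h : ℕ) (hX : FR h X) :
    gg (X ++ R) h = gg R 0 + (1 + countU R + countH R) * (countD X + countH X) +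
      (countD X + countH X) * (countU X + countH X) + countH X := by
  induction X generalizing h with
  | nil => cases h <;> simp_all [FR]
  | cons x X ih =>
    cases h with
    | zero => simp [FR] at hX
    | succ h =>
      have hk := kU_app _ R _ hX
      cases x <;> simp only [FR] at hX <;> have := ih _ hX <;>
        simp only [List.cons_append] at hk <;> simp [gg, hk, this] <;> ring

/-- The double sum of the statement. -/
def dsum (F : List (List Step)) : ℕ :=
  ∑ i ∈ Finset.range F.length, ∑ j ∈ Finset.range F.length,
          if i ≤ j then
            (countU (F.getD i []) + countH (F.getD i [])) *
              (countU (F.getD j []) + countH (F.getD j []))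
          else 0

theorem sum_flatten (F : List (List Step)) :
    ∑ j ∈ Finset.range F.length, (countU (F.getD j []) + countH (F.getD j [])) =
      countU F.flatten + countH F.flatten := by
  induction F with
  | nil => simp
  | cons f F ih =>
    rw [List.length_cons, Finset.sum_range_succ']
    simp only [List.getD_cons_succ, List.getD_cons_zero, ih]
    simp
    omega

theorem dsum_cons (f : List Step) (F : List (List Step)) :
    dsum (f :: F) = dsum F + (countU f + countH f) * (countU F.flatten + countH F.flatten) +
      (countU f + countH f) * (countU f + countH f) := by
  rw [← sum_flatten, Finset.mul_sum]
  unfold dsum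
  rw [List.length_cons, Finset.sum_range_succ', Finset.sum_range_succ']
  simp only [Finset.sum_range_succ' _ F.length, List.getD_cons_succ, List.getD_cons_zero]
  simp
  omega

theorem gg_flatten (F : List (List Step)) (hF : ∀ f ∈ F, IsIrreducibleFactor f) :
    gg F.flatten 0 = 1 + countH F.flatten + dsum F := by
  induction F with
  | nil => simp [gg, dsum]
  | cons f F ih =>
    have ih := ih fun g hg => hF g (by simp [hg])
    rw [dsum_cons]
    rcases irr_cases f (hF f (by simp)) with rfl | ⟨v, rfl, hv⟩
    · simp [gg, ih, kU]
      omega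
    · have hc := FR_counts _ _ hv
      simp [gg, kU, gg_app _ _ _ hv, ih, ← hc]
      ring

theorem schroder_covering_count (P : List Step) (F : List (List Step))
    (hP : IsSchroder P)
    (hfact : P = F.flatten)
    (hirr : ∀ f ∈ F, IsIrreducibleFactor f) :
    Nat.card {Q : List Step // IsSchroder Q ∧ P.Sublist Q ∧
        semilength Q = semilength P + 1} =
      2 + P.length +
        ∑ i ∈ Finset.range F.length, ∑ j ∈ Finset.range F.length,
          if i ≤ j then
            (countU (F.getD i []) + countH (F.getD i [])) *
              (countU (F.getD j []) + countH (F.getD j []))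
          else 0 := by
  have hV := (isSchroder_iff P).1 hP
  have hset : {Q : List Step | IsSchroder Q ∧ P.Sublist Q ∧
      semilength Q = semilength P + 1} = SS P 0 1 1 0 ∪ SS P 0 0 0 1 := by
    ext Q
    simp only [SS, Set.mem_setOf_eq, Set.mem_union, ← isSchroder_iff, semilength]
    constructor
    · rintro ⟨h1, h2, h3⟩
      have hu : countU P ≤ countU Q := h2.count_le U
      have hh : countH P ≤ countH Q := h2.count_le H
      have e1 := h1.2
      have e2 := hP.2
      by_cases hc : countU Q = countU P
      · right; exact ⟨h2, h1, by omega, by omega, by omega⟩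
      · left; exact ⟨h2, h1, by omega, by omega, by omega⟩
    · rintro (⟨h2, h1, h3, h4, h5⟩ | ⟨h2, h1, h3, h4, h5⟩) <;> exact ⟨h1, h2, by omega⟩
  have hdisj : Disjoint (SS P 0 1 1 0) (SS P 0 0 0 1) := by
    rw [Set.disjoint_left]
    rintro Q ⟨-, -, h1, -⟩ ⟨-, -, h2, -⟩
    omega
  have hcard : Nat.card {Q : List Step // IsSchroder Q ∧ P.Sublist Q ∧
      semilength Q = semilength P + 1} = (SS P 0 1 1 0 ∪ SS P 0 0 0 1).ncard := by
    rw [← hset]; rfl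
  rw [hcard, Set.ncard_union_eq hdisj (SS_finite _ _ _ _ _) (SS_finite _ _ _ _ _), card_UD _ _ hV]
  have h1 := card_H _ _ hV
  have h2 := gg_flatten F hirr
  rw [← hfact] at h2
  change _ = 2 + P.length + dsum F
  omega
end

section
/- For every n ≥ 1, the number of Schröder words of semilength n avoiding the pattern HH equals C_n + (2n−1)·C_{n−1} = ((n+3)/2)·C_n = ((n+3)/(2(n+1)))·binom(2n, n), where C_m denotes the m-th Catalan number. -/
/-- `schroderAvoidCount n P` is the number of Schröder words of semilength `n`
avoiding the pattern `P` (i.e. not containing `P` as a not-necessarily-contiguous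
subword). -/
noncomputable def schroderAvoidCount (n : ℕ) (P : List Step) : ℕ :=
  Nat.card {w : List Step // IsSchroder w ∧ semilength w = n ∧ ¬ P.Sublist w}

/-- Forget the horizontal steps. -/
def stepToDyck : Step → Option DyckStep
  | Step.U => some DyckStep.U
  | Step.D => some DyckStep.D
  | Step.H => none

def dyckToStep : DyckStep → Step
  | DyckStep.U => Step.U
  | DyckStep.D => Step.D

def strip (w : List Step) : List DyckStep := w.filterMap stepToDyck

def emb (l : List DyckStep) : List Step := l.map dyckToStep

lemma count_U_strip (w : List Step) : (strip w).count DyckStep.U = countU w := by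
  unfold strip countU
  induction w with
  | nil => rfl
  | cons a w ih => cases a <;> simp [List.filterMap_cons, stepToDyck, ih]

lemma count_D_strip (w : List Step) : (strip w).count DyckStep.D = countD w := by
  unfold strip countD
  induction w with
  | nil => rfl
  | cons a w ih => cases a <;> simp [List.filterMap_cons, stepToDyck, ih]

lemma strip_emb (l : List DyckStep) : strip (emb l) = l := by
  unfold strip emb
  induction l with
  | nil => rfl
  | cons a w ih => cases a <;> simp [stepToDyck, dyckToStep] at ih ⊢ <;> exact ih

lemma H_notMem_emb (l : List DyckStep) : Step.H ∉ emb l := by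
  unfold emb
  simp only [List.mem_map, not_exists, not_and]
  intro x _
  cases x <;> simp [dyckToStep]

lemma emb_strip (w : List Step) (h : Step.H ∉ w) : emb (strip w) = w := by
  unfold strip emb
  induction w with
  | nil => rfl
  | cons a w ih =>
    cases a <;> simp [stepToDyck, dyckToStep] at ih h ⊢ <;> exact ih h

lemma strip_append (a b : List Step) : strip (a ++ b) = strip a ++ strip b := by
  simp [strip]

lemma strip_H_cons (b : List Step) : strip (Step.H :: b) = strip b := by
  simp [strip, List.filterMap_cons, stepToDyck]

/-- The Dyck word under a Schröder word. -/
def toDyck (w : List Step) (h : IsSchroder w) : DyckWord where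
  toList := strip w
  count_U_eq_count_D := by rw [count_U_strip, count_D_strip]; exact h.2
  count_D_le_count_U i := by
    have h1 : strip w = (strip w).take i ++ (strip w).drop i := (List.take_append_drop i _).symm
    obtain ⟨a, b, hw, ha, -⟩ := List.filterMap_eq_append_iff.1 h1
    rw [← ha]
    change (strip a).count _ ≤ (strip a).count _
    rw [count_U_strip, count_D_strip]
    exact h.1 a ⟨b, hw.symm⟩

lemma isSchroder_of_strip (w : List Step) (d : DyckWord) (h : strip w = d.toList) :
    IsSchroder w := by
  constructor
  · rintro p ⟨q, rfl⟩
    rw [strip_append] at h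
    have := d.count_D_le_count_U (strip p).length
    rw [← h, List.take_left, count_U_strip, count_D_strip] at this
    exact this
  · rw [← count_U_strip, ← count_D_strip, h, d.count_U_eq_count_D]

lemma HH_sublist_iff (w : List Step) :
    ¬ [Step.H, Step.H].Sublist w ↔ countH w ≤ 1 := by
  have : [Step.H, Step.H] = List.replicate 2 Step.H := rfl
  rw [this, List.replicate_sublist_iff, countH]
  omega

abbrev AvoidHH (n : ℕ) : Type :=
  {w : List Step // IsSchroder w ∧ semilength w = n ∧ ¬ [Step.H, Step.H].Sublist w}

/-- Insert an `H` at position `i`. -/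
def insH (l : List DyckStep) (i : ℕ) : List Step :=
  emb (l.take i) ++ Step.H :: emb (l.drop i)

lemma strip_insH (l : List DyckStep) (i : ℕ) : strip (insH l i) = l := by
  rw [insH, strip_append, strip_H_cons, strip_emb, strip_emb, List.take_append_drop]

lemma countH_emb (l : List DyckStep) : countH (emb l) = 0 :=
  List.count_eq_zero.2 (H_notMem_emb l)

lemma countH_insH (l : List DyckStep) (i : ℕ) : countH (insH l i) = 1 := by
  have h := countH_emb
  unfold countH at *
  simp [insH, h]

lemma idxOf_insH (l : List DyckStep) (i : ℕ) (hi : i ≤ l.length) :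
    (insH l i).idxOf Step.H = i := by
  rw [insH, List.idxOf_append_of_notMem (H_notMem_emb _)]
  simp [emb, hi]

def build (n : ℕ) (hn : 1 ≤ n) :
    {d : DyckWord // d.semilength = n} ⊕ ({d : DyckWord // d.semilength = n - 1} × Fin (2 * n - 1))
      → AvoidHH n
  | Sum.inl d => ⟨emb d.1.toList, isSchroder_of_strip _ d.1 (strip_emb _), by
      rw [semilength, countH_emb, ← count_U_strip, strip_emb]
      exact d.2, by rw [HH_sublist_iff, countH_emb]; omega⟩
  | Sum.inr (d, i) => ⟨insH d.1.toList i, isSchroder_of_strip _ d.1 (strip_insH _ _), by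
      rw [semilength, countH_insH, ← count_U_strip, strip_insH]
      have := d.2
      unfold DyckWord.semilength at this
      omega, by rw [HH_sublist_iff, countH_insH]⟩

lemma build_injective (n : ℕ) (hn : 1 ≤ n) : Function.Injective (build n hn) := by
  rintro (d | ⟨d, i⟩) (e | ⟨e, j⟩) h <;> have h := congrArg Subtype.val h <;>
    simp only [build] at h
  · have := congrArg strip h
    rw [strip_emb, strip_emb] at this
    rw [Subtype.ext (DyckWord.ext this)]
  · have := congrArg countH h
    rw [countH_emb, countH_insH] at this
    omega
  · have := congrArg countH h
    rw [countH_emb, countH_insH] at this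
    omega
  · have h1 := congrArg strip h
    rw [strip_insH, strip_insH] at h1
    have h2 := congrArg (List.idxOf Step.H) h
    have ld := d.1.two_mul_semilength_eq_length
    have le := e.1.two_mul_semilength_eq_length
    rw [d.2] at ld
    rw [e.2] at le
    rw [idxOf_insH _ _ (by omega), idxOf_insH _ _ (by omega)] at h2
    rw [Subtype.ext (DyckWord.ext h1), Fin.ext h2]

lemma build_surjective (n : ℕ) (hn : 1 ≤ n) : Function.Surjective (build n hn) := by
  rintro ⟨w, hs, hl, ha⟩
  have hc := (HH_sublist_iff w).1 ha
  by_cases hH : Step.H ∈ w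
  · obtain ⟨a, b, rfl⟩ := List.append_of_mem hH
    have hab : Step.H ∉ a ∧ Step.H ∉ b := by
      simp only [countH, List.count_append, List.count_cons_self] at hc
      exact ⟨List.count_eq_zero.1 (by omega), List.count_eq_zero.1 (by omega)⟩
    have hc1 : countH (a ++ Step.H :: b) = 1 := by
      have := List.count_pos_iff.2 hH
      unfold countH at *
      omega
    have hsl : (toDyck _ hs).semilength = n - 1 := by
      change (strip _).count _ = _
      rw [count_U_strip]
      unfold semilength at hl
      omega
    have hst : strip (a ++ Step.H :: b) = strip a ++ strip b := by
      rw [strip_append, strip_H_cons]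
    have hlen := (toDyck _ hs).two_mul_semilength_eq_length
    rw [hsl] at hlen
    change _ = (strip _).length at hlen
    rw [hst, List.length_append] at hlen
    refine ⟨Sum.inr (⟨toDyck _ hs, hsl⟩, ⟨(strip a).length, by omega⟩), Subtype.ext ?_⟩
    change insH (strip _) (strip a).length = _
    rw [hst, insH, List.take_left, List.drop_left, emb_strip _ hab.1, emb_strip _ hab.2]
  · refine ⟨Sum.inl ⟨toDyck w hs, ?_⟩, Subtype.ext (emb_strip w hH)⟩
    change (strip _).count _ = _
    rw [count_U_strip]
    have : countH w = 0 := List.count_eq_zero.2 hH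
    unfold semilength at hl
    omega

lemma count_HH (n : ℕ) (hn : 1 ≤ n) :
    schroderAvoidCount n [Step.H, Step.H] = catalan n + (2 * n - 1) * catalan (n - 1) := by
  unfold schroderAvoidCount
  rw [← Nat.card_eq_of_bijective (build n hn) ⟨build_injective n hn, build_surjective n hn⟩,
    Nat.card_eq_fintype_card, Fintype.card_sum, Fintype.card_prod,
    DyckWord.card_dyckWord_semilength_eq_catalan, DyckWord.card_dyckWord_semilength_eq_catalan,
    Fintype.card_fin, mul_comm]

theorem schroder_avoid_HH (n : ℕ) (hn : 1 ≤ n) :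
    schroderAvoidCount n [Step.H, Step.H] = catalan n + (2 * n - 1) * catalan (n - 1) ∧
    (schroderAvoidCount n [Step.H, Step.H] : ℚ) = (((n : ℚ) + 3) / 2) * (catalan n : ℚ) ∧
    (schroderAvoidCount n [Step.H, Step.H] : ℚ) =
      (((n : ℚ) + 3) / (2 * ((n : ℚ) + 1))) * (Nat.choose (2 * n) n : ℚ) := by
  have h := count_HH n hn
  have h2 : (schroderAvoidCount n [Step.H, Step.H] : ℚ)
      = (((n : ℚ) + 3) / 2) * (catalan n : ℚ) := by
    rw [h]
    obtain ⟨m, rfl⟩ : ∃ m, n = m + 1 := ⟨n - 1, by omega⟩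
    have e1 := succ_mul_catalan_eq_centralBinom m
    have e2 := succ_mul_catalan_eq_centralBinom (m + 1)
    have e3 := Nat.succ_mul_centralBinom_succ m
    rw [← e1, ← e2] at e3
    have e4 : (m + 1 + 1) * catalan (m + 1) = 2 * (2 * m + 1) * catalan m :=
      Nat.eq_of_mul_eq_mul_left (Nat.succ_pos m) (by rw [Nat.succ_eq_add_one, e3]; ring)
    have e5 : ((m : ℚ) + 1 + 1) * catalan (m + 1) = 2 * (2 * m + 1) * catalan m := by
      exact_mod_cast e4
    have e6 : 2 * (m + 1) - 1 = 2 * m + 1 := by omega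
    rw [e6, Nat.add_sub_cancel]
    push_cast
    linarith
  refine ⟨h, h2, ?_⟩
  rw [h2]
  have e2 := succ_mul_catalan_eq_centralBinom n
  rw [Nat.centralBinom] at e2
  rw [← e2]
  have : (n : ℚ) + 1 ≠ 0 := by positivity
  push_cast
  field_simp
end
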